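/- arXiv:0802.3418 — 2 statements merged into one kernel-verified Lean document; each statement's English description precedes it below -/
import Mathlib

section
/- Let W be the subgroup of S̃_n generated by s_0, s_1, ..., s_{n-1}. Then W is a normal subgroup of S̃_n and S̃_n = Ω ⋉ W, where Ω is the cyclic subgroup generated by ω = τ_1 s_1 ⋯ s_{n-1}. -/
/-- The weight lattice `X` of the diagonal torus of `SL_n(ℂ)`:
the quotient of `ℤ^n` by the span of the constant vector `(1,…,1)`,
so that the images `τ_1, …, τ_n` of the standard basis vectors satisfy
`τ_1 + ⋯ + τ_n = 0` (multiplicatively, `τ_1 ⋯ τ_n = 1`). -/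
abbrev Xlat (n : ℕ) : Type :=
  (Fin n → ℤ) ⧸ AddSubgroup.zmultiples (1 : Fin n → ℤ)

/-- The additive automorphism of `ℤ^n` permuting the coordinates by `w`. -/
def permV (n : ℕ) (w : Equiv.Perm (Fin n)) : (Fin n → ℤ) ≃+ (Fin n → ℤ) where
  toFun v := v ∘ w.symm
  invFun v := v ∘ w
  left_inv v := by ext i; simp
  right_inv v := by ext i; simp
  map_add' _ _ := rfl

lemma permV_const (n : ℕ) (w : Equiv.Perm (Fin n)) :
    (AddSubgroup.zmultiples (1 : Fin n → ℤ)).map (permV n w) =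
      AddSubgroup.zmultiples (1 : Fin n → ℤ) := by
  ext v
  simp only [AddSubgroup.mem_map, AddSubgroup.mem_zmultiples_iff]
  constructor
  · rintro ⟨y, ⟨k, hk⟩, rfl⟩
    exact ⟨k, by subst hk; ext i; simp [permV]⟩
  · rintro ⟨k, hk⟩
    exact ⟨v, ⟨k, hk⟩, by subst hk; ext i; simp [permV]⟩

/-- The induced action of `S_n` on the lattice `X`. -/
def permX (n : ℕ) (w : Equiv.Perm (Fin n)) : Xlat n ≃+ Xlat n :=
  QuotientAddGroup.congr _ _ (permV n w) (permV_const n w)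

lemma permX_mk (n : ℕ) (w : Equiv.Perm (Fin n)) (v : Fin n → ℤ) :
    permX n w (QuotientAddGroup.mk v) = QuotientAddGroup.mk (v ∘ w.symm) :=
  rfl

/-- The action of `S_n` on (the multiplicative version of) `X`, as a group homomorphism
into the automorphism group. -/
def permAct (n : ℕ) : Equiv.Perm (Fin n) →* MulAut (Multiplicative (Xlat n)) where
  toFun w := AddEquiv.toMultiplicative (permX n w)
  map_one' := by
    ext x
    induction x using QuotientAddGroup.induction_on with
    | H v => simp [AddEquiv.toMultiplicative, permX_mk]; rfl
  map_mul' w u := by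
    ext x
    induction x using QuotientAddGroup.induction_on with
    | H v => simp [AddEquiv.toMultiplicative, permX_mk]; rfl

/-- The extended affine symmetric group `S̃_n = S_n ⋉ X`. -/
abbrev AffSn (n : ℕ) : Type :=
  SemidirectProduct (Multiplicative (Xlat n)) (Equiv.Perm (Fin n)) (permAct n)

/-- The element `τ_i` of `S̃_n`, `i = 1, …, n` (0-indexed here). -/
def tau (n : ℕ) (i : Fin n) : AffSn n :=
  SemidirectProduct.inl (Multiplicative.ofAdd
    (QuotientAddGroup.mk (Pi.single i 1) : Xlat n))

/-- The copy of a finite permutation inside `S̃_n`. -/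
def fperm (n : ℕ) (w : Equiv.Perm (Fin n)) : AffSn n := SemidirectProduct.inr w


/-- `⟨i mod n⟩` as an element of `Fin n`. -/
def finOf (n : ℕ) [NeZero n] (i : ℕ) : Fin n := ⟨i % n, Nat.mod_lt _ (NeZero.pos n)⟩

/-- The element `τ_i` of `S̃_n` where `i` is a 0-indexed natural number
(so `tauN n 0, …, tauN n (n-1)` are `τ_1, …, τ_n` of the paper). -/
def tauN (n : ℕ) [NeZero n] (i : ℕ) : AffSn n := tau n (finOf n i)

/-- The simple reflection `s_j = (j, j+1)` of `S_n` (1-indexed: `j = 1, …, n-1`),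
written 0-indexed as the swap of `j-1` and `j`. -/
def sNp (n : ℕ) [NeZero n] (j : ℕ) : Equiv.Perm (Fin n) :=
  Equiv.swap (finOf n (j - 1)) (finOf n j)

/-- The finite simple reflection `s_j` viewed inside `S̃_n` (1-indexed). -/
def sfin (n : ℕ) [NeZero n] (j : ℕ) : AffSn n := fperm n (sNp n j)

/-- The affine simple reflection `s_0 = s·τ_1^2 τ_2 ⋯ τ_{n-1}`, where `s = (1,n)`. -/
def s0 (n : ℕ) [NeZero n] : AffSn n :=
  fperm n (Equiv.swap (finOf n 0) (finOf n (n - 1))) * tauN n 0 *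
    ((List.range (n - 1)).map (tauN n)).prod

/-- The element `ω = τ_1 s_1 s_2 ⋯ s_{n-1}` of `S̃_n`. -/
def om (n : ℕ) [NeZero n] : AffSn n :=
  tauN n 0 * ((List.range (n - 1)).map (fun i => sfin n (i + 1))).prod

/-- The simple reflections `s_0, s_1, …, s_{n-1}` of the affine Weyl group,
indexed by `Fin n` (with `s_0` the affine reflection). -/
def saff (n : ℕ) [NeZero n] (i : Fin n) : AffSn n :=
  if (i : ℕ) = 0 then s0 n else sfin n i

/-- The element `x_i = τ_1 τ_2 ⋯ τ_i` of `S̃_n` (so `xel n i` for `1 ≤ i ≤ n-1`). -/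
def xel (n : ℕ) [NeZero n] (i : ℕ) : AffSn n :=
  ((List.range i).map (tauN n)).prod

/-- The length function on the extended affine symmetric group
`S̃_n = Ω ⋉ W`: `l(ω^a w) = l(w)` where `l` on the affine Weyl group `W`
(generated by `s_0, …, s_{n-1}`) is the Coxeter length, realized as the minimal
length of a word in the generators `s_0, …, s_{n-1}`. -/
noncomputable def lenT (n : ℕ) [NeZero n] (g : AffSn n) : ℕ :=
  sInf {m | ∃ (a : ℤ) (l : List (Fin n)),
    l.length = m ∧ g = om n ^ a * (l.map (saff n)).prod}

/-- Translation by a vector. -/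
def Tv (n : ℕ) (v : Fin n → ℤ) : AffSn n :=
  SemidirectProduct.inl (Multiplicative.ofAdd (QuotientAddGroup.mk v : Xlat n))

lemma Tv_add (n : ℕ) (v w : Fin n → ℤ) : Tv n (v + w) = Tv n v * Tv n w := by
  unfold Tv
  rw [← map_mul]
  rfl

lemma Tv_zero (n : ℕ) : Tv n 0 = 1 := by
  have h := Tv_add n 0 0
  simpa using h

lemma Tv_neg (n : ℕ) (v : Fin n → ℤ) : Tv n (-v) = (Tv n v)⁻¹ := by
  rw [eq_inv_iff_mul_eq_one, ← Tv_add, neg_add_cancel, Tv_zero]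

lemma Tv_const (n : ℕ) (k : ℤ) : Tv n (k • (1 : Fin n → ℤ)) = 1 := by
  have : (QuotientAddGroup.mk (k • (1 : Fin n → ℤ)) : Xlat n) = 0 :=
    (QuotientAddGroup.eq_zero_iff _).2 ⟨k, rfl⟩
  unfold Tv
  rw [this]
  rfl

lemma Tv_conj (n : ℕ) (w : Equiv.Perm (Fin n)) (v : Fin n → ℤ) :
    fperm n w * Tv n v * fperm n w⁻¹ = Tv n (v ∘ w.symm) := by
  have := SemidirectProduct.inl_aut (φ := permAct n) w
    (Multiplicative.ofAdd (QuotientAddGroup.mk v : Xlat n))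
  exact this.symm

lemma fperm_mul (n : ℕ) (w u : Equiv.Perm (Fin n)) :
    fperm n (w * u) = fperm n w * fperm n u := by
  unfold fperm; rw [map_mul]

lemma fperm_one (n : ℕ) : fperm n 1 = 1 := by
  unfold fperm; rw [map_one]

lemma fperm_comm (n : ℕ) (w : Equiv.Perm (Fin n)) (v : Fin n → ℤ) :
    fperm n w * Tv n v = Tv n (v ∘ w.symm) * fperm n w := by
  rw [← Tv_conj, mul_assoc, ← fperm_mul]; simp [fperm_one]

lemma exists_form (n : ℕ) (g : AffSn n) : ∃ v w, g = Tv n v * fperm n w := by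
  obtain ⟨v, hv⟩ := QuotientAddGroup.mk_surjective (Multiplicative.toAdd g.left)
  refine ⟨v, g.right, ?_⟩
  unfold Tv fperm
  rw [hv]
  exact (SemidirectProduct.inl_left_mul_inr_right g).symm

/-- Sum of coordinates mod n. -/
def sumV (n : ℕ) : (Fin n → ℤ) →+ ZMod n where
  toFun v := ((∑ i, v i : ℤ) : ZMod n)
  map_zero' := by simp
  map_add' v w := by simp [Finset.sum_add_distrib]

/-- Sum of coordinates on the lattice. -/
def sumX (n : ℕ) : Xlat n →+ ZMod n :=
  QuotientAddGroup.lift _ (sumV n) (by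
    rintro _ ⟨k, rfl⟩
    simp [sumV])

lemma sumX_mk (n : ℕ) (v : Fin n → ℤ) :
    sumX n (QuotientAddGroup.mk v) = ((∑ i, v i : ℤ) : ZMod n) := rfl

/-- The degree homomorphism. -/
def degH (n : ℕ) : AffSn n →* Multiplicative (ZMod n) :=
  SemidirectProduct.lift (AddMonoidHom.toMultiplicative (sumX n)) 1 (by
    intro w
    refine MonoidHom.ext fun x => ?_
    induction x using QuotientAddGroup.induction_on with
    | H v =>
      simp only [MonoidHom.one_apply, map_one, MonoidHom.comp_apply]
      change Multiplicative.ofAdd (sumX n (QuotientAddGroup.mk (v ∘ w.symm)))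
        = Multiplicative.ofAdd (sumX n (QuotientAddGroup.mk v))
      rw [sumX_mk, sumX_mk]
      congr 2
      exact Equiv.sum_comp w.symm v)

lemma degH_Tv (n : ℕ) (v : Fin n → ℤ) :
    degH n (Tv n v) = Multiplicative.ofAdd ((∑ i, v i : ℤ) : ZMod n) := by
  unfold degH Tv
  rw [SemidirectProduct.lift_inl]
  rfl

lemma degH_fperm (n : ℕ) (w : Equiv.Perm (Fin n)) : degH n (fperm n w) = 1 := by
  unfold degH fperm
  rw [SemidirectProduct.lift_inr]
  rfl

lemma tauN_eq (n : ℕ) [NeZero n] (i : ℕ) : tauN n i = Tv n (Pi.single (finOf n i) 1) := rfl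

lemma prod_tau (n : ℕ) [NeZero n] (m : ℕ) :
    ((List.range m).map (tauN n)).prod
      = Tv n (∑ j ∈ Finset.range m, Pi.single (finOf n j) 1) := by
  induction m with
  | zero => simp [Tv_zero]
  | succ m ih => simp [List.range_succ, Finset.sum_range_succ, Tv_add, ih, tauN_eq]

lemma sum_all (n : ℕ) [NeZero n] :
    (∑ j ∈ Finset.range n, (Pi.single (finOf n j) 1 : Fin n → ℤ)) = 1 := by
  rw [Finset.sum_range]
  have : ∀ i : Fin n, finOf n (i : ℕ) = i := fun i => by
    ext; simp [finOf, Nat.mod_eq_of_lt i.2]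
  simp only [this]
  exact Finset.univ_sum_single (1 : Fin n → ℤ)

lemma s0_eq (n : ℕ) [NeZero n] :
    s0 n = fperm n (Equiv.swap (finOf n 0) (finOf n (n - 1))) *
      Tv n (Pi.single (finOf n 0) 1 - Pi.single (finOf n (n - 1)) 1) := by
  unfold s0
  rw [prod_tau, tauN_eq, mul_assoc, ← Tv_add]
  have h := sum_all n
  obtain ⟨m, rfl⟩ : ∃ m, n = m + 1 := ⟨n - 1, by have := NeZero.pos n; omega⟩
  rw [Finset.sum_range_succ] at h
  simp only [Nat.add_sub_cancel]
  rw [eq_sub_of_add_eq h]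
  have : (Pi.single (finOf (m+1) 0) 1 + (1 - Pi.single (finOf (m+1) m) 1) : Fin (m+1) → ℤ)
    = (Pi.single (finOf (m+1) 0) 1 - Pi.single (finOf (m+1) m) 1) + (1 : ℤ) • 1 := by
    rw [one_smul]; abel
  rw [this, Tv_add, Tv_const, mul_one]

lemma prod_s (n : ℕ) [NeZero n] (m : ℕ) :
    ((List.range m).map (fun i => sfin n (i + 1))).prod
      = fperm n ((List.range m).map (fun i => sNp n (i + 1))).prod := by
  induction m with
  | zero => simp [fperm_one]
  | succ m ih => 
    rw [List.range_succ, List.map_append, List.map_append, List.prod_append, List.prod_append,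
      ih, fperm_mul]
    simp [sfin]

lemma prod_sNp (n : ℕ) [NeZero n] (m : ℕ) (hm : m < n) (i : ℕ) (hi : i < n) :
    ((List.range m).map (fun i => sNp n (i + 1))).prod (finOf n i)
      = if i < m then finOf n (i + 1) else if i = m then finOf n 0 else finOf n i := by
  have inj : ∀ a b, a < n → b < n → (finOf n a = finOf n b ↔ a = b) := by
    intro a b ha hb
    simp [finOf, Nat.mod_eq_of_lt ha, Nat.mod_eq_of_lt hb]
  induction m generalizing i with
  | zero =>
    simp only [List.range_zero, List.map_nil, List.prod_nil, Equiv.Perm.one_apply]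
    split_ifs <;> simp_all
  | succ m ih =>
    rw [List.range_succ, List.map_append, List.prod_append, Equiv.Perm.mul_apply]
    simp only [List.map_cons, List.map_nil, List.prod_singleton]
    have hs : sNp n (m + 1) (finOf n i) =
        if i = m then finOf n (m + 1) else if i = m + 1 then finOf n m else finOf n i := by
      simp only [sNp, Nat.add_sub_cancel, Equiv.swap_apply_def, inj i m hi (by omega),
        inj i (m + 1) hi hm]
    rw [hs]
    have hm' : m < n := by omega
    split_ifs <;> first | omega | skip
    all_goals (rw [ih hm' _ (by omega)]; split_ifs <;> first | omega | rfl | (subst_vars; rfl))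

/-- The permutation part of `ω`. -/
def cyc (n : ℕ) [NeZero n] : Equiv.Perm (Fin n) :=
  ((List.range (n - 1)).map (fun i => sNp n (i + 1))).prod

lemma cyc_apply (n : ℕ) [NeZero n] (i : ℕ) : cyc n (finOf n i) = finOf n (i + 1) := by
  have hn := NeZero.pos n
  have h1 : finOf n i = finOf n (i % n) := by simp [finOf]
  have h2 : finOf n (i + 1) = finOf n (i % n + 1) := by simp [finOf]
  rw [h1, h2, cyc, prod_sNp n (n - 1) (by omega) _ (Nat.mod_lt _ hn)]
  have := Nat.mod_lt i hn
  split_ifs with h h'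
  · rfl
  · rw [h']
    have : n - 1 + 1 = n := by omega
    rw [this]; simp [finOf]
  · omega

lemma om_eq (n : ℕ) [NeZero n] : om n = Tv n (Pi.single (finOf n 0) 1) * fperm n (cyc n) := by
  unfold om
  rw [prod_s, tauN_eq]; rfl

lemma cyc_pow (n : ℕ) [NeZero n] (k i : ℕ) : (cyc n ^ k) (finOf n i) = finOf n (i + k) := by
  induction k with
  | zero => simp
  | succ k ih => rw [pow_succ', Equiv.Perm.mul_apply, ih, cyc_apply]; rfl

lemma single_comp (n : ℕ) (w : Equiv.Perm (Fin n)) (i : Fin n) :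
    (Pi.single i 1 : Fin n → ℤ) ∘ w.symm = Pi.single (w i) 1 := by
  ext j
  simp [Pi.single_apply, Equiv.symm_apply_eq]

lemma om_pow (n : ℕ) [NeZero n] (k : ℕ) :
    om n ^ k = Tv n (∑ j ∈ Finset.range k, Pi.single (finOf n j) 1) * fperm n (cyc n ^ k) := by
  induction k with
  | zero => simp [Tv_zero, fperm_one]
  | succ k ih =>
    rw [pow_succ, ih, om_eq, mul_assoc, ← mul_assoc (fperm n _), fperm_comm, single_comp,
      cyc_pow, Finset.sum_range_succ, Tv_add, pow_succ, fperm_mul, zero_add]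
    simp only [mul_assoc]

lemma om_pow_n (n : ℕ) [NeZero n] : om n ^ n = 1 := by
  rw [om_pow, sum_all]
  have h1 := Tv_const n 1
  rw [one_smul] at h1
  have h2 : cyc n ^ n = 1 := by
    ext i
    have : finOf n (i : ℕ) = i := by ext; simp [finOf, Nat.mod_eq_of_lt i.2]
    rw [← this, cyc_pow]; simp [finOf]
  rw [h1, h2, fperm_one, one_mul]

lemma degH_om (n : ℕ) [NeZero n] : degH n (om n) = Multiplicative.ofAdd 1 := by
  rw [om_eq, map_mul, degH_Tv, degH_fperm, mul_one]; simp

lemma fperm_mem (n : ℕ) [NeZero n] (w : Equiv.Perm (Fin n)) :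
    fperm n w ∈ Subgroup.closure (Set.range (saff n)) := by
  obtain ⟨m, rfl⟩ : ∃ m, n = m + 1 := ⟨n - 1, by have := NeZero.pos n; omega⟩
  have hw : w ∈ Submonoid.closure
      (Set.range fun i : Fin m => Equiv.swap i.castSucc i.succ) := by
    rw [Equiv.Perm.mclosure_swap_castSucc_succ]; trivial
  induction hw using Submonoid.closure_induction with
  | mem x hx =>
    obtain ⟨i, rfl⟩ := hx
    apply Subgroup.subset_closure
    refine ⟨i.succ, ?_⟩
    simp only [saff, Fin.val_succ, Nat.succ_ne_zero, if_false, sfin, sNp, Nat.add_sub_cancel]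
    congr 2
    · ext; simp [finOf, Nat.mod_eq_of_lt (show (i : ℕ) < m + 1 by omega)]
    · ext; simp [finOf, Nat.mod_eq_of_lt (show (i : ℕ) + 1 < m + 1 by omega)]
  | one => rw [fperm_one]; exact one_mem _
  | mul x y _ _ hx hy => rw [fperm_mul]; exact mul_mem hx hy

lemma diff_mem (n : ℕ) [NeZero n] (hn : 2 ≤ n) (i : Fin n) :
    Tv n (Pi.single i 1 - Pi.single (finOf n 0) 1) ∈ Subgroup.closure (Set.range (saff n)) := by
  have h0 : s0 n ∈ Subgroup.closure (Set.range (saff n)) :=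
    Subgroup.subset_closure ⟨⟨0, by omega⟩, by simp [saff]⟩
  rw [s0_eq, Subgroup.mul_mem_cancel_left _ (fperm_mem n _), ← inv_mem_iff, ← Tv_neg,
    neg_sub] at h0
  by_cases hi : i = finOf n 0
  · rw [hi, sub_self, Tv_zero]; exact one_mem _
  have hl : finOf n (n - 1) ≠ finOf n 0 := by
    simp [finOf, Nat.mod_eq_of_lt (show n - 1 < n by omega)]; omega
  have h := mul_mem (mul_mem (fperm_mem n (Equiv.swap (finOf n (n - 1)) i)) h0)
    (fperm_mem n (Equiv.swap (finOf n (n - 1)) i)⁻¹)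
  rw [Tv_conj] at h
  convert h using 2
  have e : ∀ (a b : Fin n → ℤ) (f : Fin n → Fin n), (a - b) ∘ f = a ∘ f - b ∘ f :=
    fun _ _ _ => rfl
  rw [e, single_comp, single_comp, Equiv.swap_apply_left,
    Equiv.swap_apply_of_ne_of_ne hl.symm (Ne.symm hi)]

lemma Tv_mem (n : ℕ) [NeZero n] (hn : 2 ≤ n) (v : Fin n → ℤ) (hv : ∑ i, v i = 0) :
    Tv n v ∈ Subgroup.closure (Set.range (saff n)) := by
  let H : AddSubgroup (Fin n → ℤ) :=
    { carrier := {v | Tv n v ∈ Subgroup.closure (Set.range (saff n))}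
      zero_mem' := by
        change Tv n 0 ∈ Subgroup.closure (Set.range (saff n))
        rw [Tv_zero]; exact one_mem _
      add_mem' := by
        intro a b ha hb
        change Tv n (a + b) ∈ Subgroup.closure (Set.range (saff n))
        rw [Tv_add]; exact mul_mem ha hb
      neg_mem' := by
        intro a ha
        change Tv n (-a) ∈ Subgroup.closure (Set.range (saff n))
        rw [Tv_neg]; exact inv_mem ha }
  have h : (∑ i, v i • (Pi.single i 1 - Pi.single (finOf n 0) 1 : Fin n → ℤ)) ∈ H :=
    sum_mem fun i _ => H.zsmul_mem (show _ ∈ H from diff_mem n hn i) _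
  have e : (∑ i, v i • (Pi.single i 1 - Pi.single (finOf n 0) 1 : Fin n → ℤ)) = v := by
    simp only [smul_sub, Finset.sum_sub_distrib, ← Finset.sum_smul, hv, zero_smul, sub_zero]
    ext j
    simp [Finset.sum_apply, Pi.single_apply]
  rw [e] at h
  exact h

lemma closure_eq_ker (n : ℕ) [NeZero n] (hn : 2 ≤ n) :
    Subgroup.closure (Set.range (saff n)) = (degH n).ker := by
  apply le_antisymm
  · rw [Subgroup.closure_le]
    rintro _ ⟨i, rfl⟩
    change degH n (saff n i) = 1
    unfold saff
    split_ifs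
    · rw [s0_eq, map_mul, degH_fperm, degH_Tv, one_mul]
      simp [Finset.sum_sub_distrib]
    · exact degH_fperm _ _
  · intro g hg
    obtain ⟨v, w, rfl⟩ := exists_form n g
    rw [MonoidHom.mem_ker, map_mul, degH_fperm, mul_one, degH_Tv, ofAdd_eq_one,
      ZMod.intCast_zmod_eq_zero_iff_dvd] at hg
    obtain ⟨k, hk⟩ := hg
    refine mul_mem ?_ (fperm_mem n w)
    have h := Tv_mem n hn (v + (-k) • 1) (by
      simp [Finset.sum_add_distrib, hk])
    rwa [Tv_add, Tv_const, mul_one] at h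

/-- The subgroup `W` of `S̃_n` generated by the simple reflections
`s_0, s_1, …, s_{n-1}` is normal, and `S̃_n = Ω ⋉ W` where `Ω` is the cyclic
subgroup generated by `ω`: that is, `Ω ∩ W = 1` and `Ω W = S̃_n`. -/
theorem affine_decomposition (n : ℕ) [NeZero n] (hn : 2 ≤ n) :
    (Subgroup.closure (Set.range (saff n))).Normal ∧
    Subgroup.zpowers (om n) ⊓ Subgroup.closure (Set.range (saff n)) = ⊥ ∧
    Subgroup.zpowers (om n) ⊔ Subgroup.closure (Set.range (saff n)) = ⊤ := by
  rw [closure_eq_ker n hn]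
  refine ⟨inferInstance, ?_, ?_⟩
  · rw [eq_bot_iff]
    rintro _ ⟨⟨k, rfl⟩, hk⟩
    have hk' : degH n (om n ^ k) = 1 := hk
    rw [map_zpow, degH_om, ← ofAdd_zsmul, ofAdd_eq_one, zsmul_one,
      ZMod.intCast_zmod_eq_zero_iff_dvd] at hk'
    obtain ⟨m, rfl⟩ := hk'
    change om n ^ ((n : ℤ) * m) = 1
    rw [zpow_mul, zpow_natCast, om_pow_n, one_zpow]
  · rw [eq_top_iff]
    intro g _
    obtain ⟨k, hk⟩ := ZMod.intCast_surjective (Multiplicative.toAdd (degH n g))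
    have : g = om n ^ k * ((om n ^ k)⁻¹ * g) := by group
    rw [this]
    refine Subgroup.mul_mem_sup ⟨k, rfl⟩ ?_
    rw [MonoidHom.mem_ker, map_mul, map_inv, inv_mul_eq_one, map_zpow, degH_om, ← ofAdd_zsmul,
      zsmul_one, hk]
    rfl
end

section
/- In the extended affine symmetric group S̃_n with ω = τ_1 s_1⋯s_{n-1}, the element x_i = τ_1⋯τ_i satisfies x_i = ω^i (s_{n-i} s_{n-i-1} ⋯ s_1)(s_{n-i+1} s_{n-i} ⋯ s_2) ⋯ (s_{n-1} s_{n-2} ⋯ s_i), and this expression for ω^{-i} x_i is reduced, so l(x_i) = i(n-i). -/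
namespace XW

/-- The element with translation part `v` and finite part `w`. -/
def E (n : ℕ) (v : Fin n → ℤ) (w : Equiv.Perm (Fin n)) : AffSn n :=
  ⟨Multiplicative.ofAdd (QuotientAddGroup.mk v : Xlat n), w⟩

lemma E_mul (n : ℕ) (v v' : Fin n → ℤ) (w w' : Equiv.Perm (Fin n)) :
    E n v w * E n v' w' = E n (v + v' ∘ w.symm) (w * w') := rfl

lemma E_one (n : ℕ) : E n 0 1 = 1 := rfl

lemma E_eq {n : ℕ} {v v' : Fin n → ℤ} {w w' : Equiv.Perm (Fin n)}
    (h : E n v w = E n v' w') : w = w' ∧ ∃ m : ℤ, ∀ x, v' x = v x + m := by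
  have h1 : (QuotientAddGroup.mk v : Xlat n) = QuotientAddGroup.mk v' :=
    congrArg (fun g : AffSn n => Multiplicative.toAdd g.left) h
  refine ⟨congrArg (fun g : AffSn n => g.right) h, ?_⟩
  rw [QuotientAddGroup.eq, AddSubgroup.mem_zmultiples_iff] at h1
  obtain ⟨m, hm⟩ := h1
  refine ⟨m, fun x => ?_⟩
  have := congrFun hm x
  simp at this
  linarith

lemma E_congr {n : ℕ} {v v' : Fin n → ℤ} {w w' : Equiv.Perm (Fin n)} (m : ℤ)
    (hw : w = w') (hv : ∀ x, v' x = v x + m) : E n v w = E n v' w' := by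
  subst hw
  have : (QuotientAddGroup.mk v : Xlat n) = QuotientAddGroup.mk v' := by
    rw [QuotientAddGroup.eq, AddSubgroup.mem_zmultiples_iff]
    refine ⟨m, ?_⟩
    ext x
    simp [hv x]
  unfold E
  rw [this]

lemma tauN_eq (n : ℕ) [NeZero n] (k : ℕ) :
    tauN n k = E n (Pi.single (finOf n k) 1) 1 := rfl

lemma fperm_eq (n : ℕ) (w : Equiv.Perm (Fin n)) : fperm n w = E n 0 w := rfl

lemma fperm_prod (n : ℕ) [NeZero n] (l : List ℕ) :
    (l.map (sfin n)).prod = fperm n ((l.map (sNp n)).prod) := by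
  induction l with
  | nil => rfl
  | cons a l ih =>
    simp only [List.map_cons, List.prod_cons, ih]
    unfold sfin fperm
    rw [map_mul]

lemma finOf_val (n : ℕ) [NeZero n] (k : ℕ) (h : k < n) : (finOf n k : ℕ) = k :=
  Nat.mod_eq_of_lt h

/-- Indicator of the first `k` coordinates. -/
def ind (n k : ℕ) : Fin n → ℤ := fun x => if (x : ℕ) < k then 1 else 0

lemma ind_succ (n : ℕ) [NeZero n] (k : ℕ) (h : k < n) :
    ind n k + Pi.single (finOf n k) 1 = ind n (k + 1) := by
  ext x
  have := finOf_val n k h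
  simp only [ind, Pi.add_apply, Pi.single_apply, Fin.ext_iff, this]
  split_ifs <;> omega

lemma xel_eq (n : ℕ) [NeZero n] (k : ℕ) (h : k ≤ n) : xel n k = E n (ind n k) 1 := by
  induction k with
  | zero =>
    rw [xel]; simp
    rw [← E_one]; congr 1
  | succ k ih =>
    have := ih (by omega)
    rw [xel] at this ⊢
    rw [List.range_succ, List.map_append, List.prod_append, this, ← ind_succ n k (by omega)]
    simp only [List.map_cons, List.map_nil, List.prod_cons, List.prod_nil, mul_one, tauN_eq, E_mul]
    rfl

lemma sNp_val (n : ℕ) [NeZero n] (j : ℕ) (h1 : 1 ≤ j) (h2 : j < n) (x : Fin n) :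
    (sNp n j x : ℕ) = if (x : ℕ) = j - 1 then j else if (x : ℕ) = j then j - 1 else x := by
  have e1 := finOf_val n j h2
  have e2 := finOf_val n (j - 1) (by omega)
  simp only [sNp, Equiv.swap_apply_def, Fin.ext_iff, e1, e2]
  split_ifs <;> simp [e1, e2]

/-- The finite part of `ω`. -/
def cyc (n : ℕ) [NeZero n] : Equiv.Perm (Fin n) :=
  ((List.range (n - 1)).map (fun i => sNp n (i + 1))).prod

lemma cyc_aux (n : ℕ) [NeZero n] (m : ℕ) (h : m ≤ n - 1) (x : Fin n) :
    ((((List.range m).map (fun i => sNp n (i + 1))).prod x : Fin n) : ℕ) =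
      if (x : ℕ) < m then (x : ℕ) + 1 else if (x : ℕ) = m then 0 else (x : ℕ) := by
  induction m generalizing x with
  | zero =>
    simp only [List.range_zero, List.map_nil, List.prod_nil, Equiv.Perm.one_apply]
    split_ifs <;> omega
  | succ m ih =>
    have hx := x.2
    rw [List.range_succ, List.map_append, List.prod_append]
    simp only [List.map_cons, List.map_nil, List.prod_cons, List.prod_nil, mul_one,
      Equiv.Perm.mul_apply]
    rw [ih (by omega), sNp_val n (m + 1) (by omega) (by omega)]
    split_ifs <;> omega

lemma cyc_val (n : ℕ) [NeZero n] (x : Fin n) : (cyc n x : ℕ) = (x + 1) % n := by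
  have hx := x.2
  rw [cyc, cyc_aux n (n - 1) le_rfl]
  split_ifs with h1 h2
  · rw [Nat.mod_eq_of_lt (by omega)]
  · have : (x : ℕ) + 1 = n := by omega
    rw [this, Nat.mod_self]
  · omega

lemma cyc_pow_val (n : ℕ) [NeZero n] (k : ℕ) (x : Fin n) :
    ((cyc n ^ k) x : ℕ) = (x + k) % n := by
  induction k with
  | zero => simp [Nat.mod_eq_of_lt x.2]
  | succ k ih =>
    rw [pow_succ', Equiv.Perm.mul_apply, cyc_val, ih, Nat.mod_add_mod, add_assoc]

lemma om_eq (n : ℕ) [NeZero n] : om n = E n (Pi.single (finOf n 0) 1) (cyc n) := by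
  have : ((List.range (n - 1)).map (fun i => sfin n (i + 1))).prod = fperm n (cyc n) := by
    have := fperm_prod n ((List.range (n - 1)).map (fun i => i + 1))
    simpa [List.map_map, Function.comp_def, cyc] using this
  rw [om, this, tauN_eq, fperm_eq, E_mul]
  congr 1
  ext x; simp

lemma om_pow (n : ℕ) [NeZero n] (k : ℕ) (h : k ≤ n) :
    om n ^ k = E n (ind n k) (cyc n ^ k) := by
  induction k with
  | zero => rw [pow_zero, ← E_one]; congr 1
  | succ k ih =>
    rw [pow_succ, ih (by omega), om_eq, E_mul, ← ind_succ n k (by omega), pow_succ]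
    congr 2
    ext x
    have : (cyc n ^ k) (finOf n 0) = finOf n k := by
      apply Fin.ext
      rw [cyc_pow_val, finOf_val n 0 (NeZero.pos n)]
      simp [finOf]
    simp only [Function.comp_apply, Pi.single_apply, Equiv.symm_apply_eq, this]

lemma om_pow_n (n : ℕ) [NeZero n] : om n ^ n = 1 := by
  rw [om_pow n n le_rfl, ← E_one]
  refine E_congr (-1) ?_ ?_
  · ext x
    rw [cyc_pow_val]
    simp [Nat.mod_eq_of_lt x.2]
  · intro x
    simp [ind]

/-- One block. -/
lemma block_aux (n : ℕ) [NeZero n] (a R : ℕ) (ha : a < n) (hR : R ≤ a) (x : Fin n) :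
    ((((List.range R).map (fun r => sNp n (a - r))).prod x : Fin n) : ℕ) =
      if (x : ℕ) = a - R then a else if a - R < (x : ℕ) ∧ (x : ℕ) ≤ a then (x : ℕ) - 1 else (x : ℕ) := by
  induction R generalizing x with
  | zero =>
    simp only [List.range_zero, List.map_nil, List.prod_nil, Equiv.Perm.one_apply]
    split_ifs <;> omega
  | succ R ih =>
    have hx := x.2
    rw [List.range_succ, List.map_append, List.prod_append]
    simp only [List.map_cons, List.map_nil, List.prod_cons, List.prod_nil, mul_one,
      Equiv.Perm.mul_apply]
    rw [ih (by omega), sNp_val n (a - R) (by omega) (by omega)]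
    split_ifs <;> omega

/-- The word of the theorem. -/
def wd (m T : ℕ) : List ℕ :=
  ((List.range T).map (fun t => (List.range m).map (fun r => m + t - r))).flatten

lemma wd_succ (m T : ℕ) : wd m (T + 1) = wd m T ++ (List.range m).map (fun r => m + T - r) := by
  simp [wd, List.range_succ]

lemma wd_length (m T : ℕ) : (wd m T).length = T * m := by
  induction T with
  | zero => simp [wd]
  | succ T ih => rw [wd_succ, List.length_append, ih]; simp; ring

lemma wd_mem (m T j : ℕ) (h : j ∈ wd m T) : 1 ≤ j ∧ j < m + T := by
  simp only [wd, List.mem_flatten, List.mem_map, List.mem_range] at h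
  obtain ⟨_, ⟨t, ht, rfl⟩, hj⟩ := h
  simp only [List.mem_map, List.mem_range] at hj
  obtain ⟨r, hr, rfl⟩ := hj
  omega

lemma wd_perm (n : ℕ) [NeZero n] (m T : ℕ) (h : m + T ≤ n) (x : Fin n) :
    ((((wd m T).map (sNp n)).prod x : Fin n) : ℕ) =
      if (x : ℕ) < T then x + m else if (x : ℕ) < T + m then x - T else x := by
  induction T generalizing x with
  | zero => simp [wd]
  | succ T ih =>
    have hx := x.2
    rw [wd_succ, List.map_append, List.prod_append, Equiv.Perm.mul_apply, ih (by omega),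
      List.map_map]
    have := block_aux n (m + T) m (by omega) (by omega) x
    simp only [Function.comp_def]
    rw [this]
    split_ifs <;> omega

/-- Twice the contribution of a pair to the length. -/
def G {n : ℕ} (u : Fin n → ℤ) (w : Fin n → Fin n) (x y : Fin n) : ℤ :=
  if x < y then |u x - u y - (if w y < w x then 1 else 0)|
  else if y < x then |u y - u x - (if w x < w y then 1 else 0)| else 0

/-- Twice the length. -/
def F {n : ℕ} (u : Fin n → ℤ) (w : Fin n → Fin n) : ℤ := ∑ x, ∑ y, G u w x y

lemma F_step {n : ℕ} (u u' : Fin n → ℤ) (w w' : Fin n → Fin n) (a b : Fin n)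
    (h : ∀ x y, G u' w' (Equiv.swap a b x) (Equiv.swap a b y) ≤
      G u w x y + (if x = a then (if y = b then 1 else 0) else 0)
        + (if x = b then (if y = a then 1 else 0) else 0)) :
    F u' w' ≤ F u w + 2 := by
  have e : F u' w' = ∑ x, ∑ y, G u' w' (Equiv.swap a b x) (Equiv.swap a b y) := by
    unfold F
    rw [← Equiv.sum_comp (Equiv.swap a b)]
    refine Finset.sum_congr rfl fun x _ => ?_
    rw [← Equiv.sum_comp (Equiv.swap a b)]
  rw [e]
  refine (Finset.sum_le_sum fun x _ => Finset.sum_le_sum fun y _ => h x y).trans ?_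
  simp only [Finset.sum_add_distrib]
  have k : ∀ a b : Fin n, ∑ x, ∑ y, (if x = a then (if y = b then (1:ℤ) else 0) else 0) = 1 := by
    intro a b
    rw [Finset.sum_eq_single a]
    · simp
    · intro c _ hc; simp [hc]
    · simp
  rw [k, k, F]
  linarith

lemma G_fin {n : ℕ} (u : Fin n → ℤ) (w : Equiv.Perm (Fin n)) (a b : Fin n)
    (hab : (a : ℕ) + 1 = b) (x y : Fin n) :
    G (u ∘ Equiv.swap a b) (w ∘ Equiv.swap a b) (Equiv.swap a b x) (Equiv.swap a b y) ≤
      G u w x y + (if x = a then (if y = b then 1 else 0) else 0)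
        + (if x = b then (if y = a then 1 else 0) else 0) := by
  have hinj : w x = w y → x = y := fun h => w.injective h
  simp only [G, Function.comp_apply, Equiv.swap_apply_self]
  simp only [Equiv.swap_apply_def]
  simp only [Fin.lt_def, Fin.ext_iff] at *
  generalize (w x : ℕ) = p at *
  generalize (w y : ℕ) = q at *
  generalize u x = c at *
  generalize u y = d at *
  split_ifs <;> grind

set_option maxHeartbeats 4000000 in
lemma G_aff {n : ℕ} (u u' : Fin n → ℤ) (w : Equiv.Perm (Fin n)) (a b : Fin n)
    (ha : (a : ℕ) = 0) (hb : (b : ℕ) + 1 = n) (hab : a ≠ b)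
    (hu : ∀ x, u' (Equiv.swap a b x) = u x + (if x = b then 1 else 0) - (if x = a then 1 else 0))
    (x y : Fin n) :
    G u' (w ∘ Equiv.swap a b) (Equiv.swap a b x) (Equiv.swap a b y) ≤
      G u w x y + (if x = a then (if y = b then 1 else 0) else 0)
        + (if x = b then (if y = a then 1 else 0) else 0) := by
  have hinj : w x = w y → x = y := fun h => w.injective h
  simp only [G, Function.comp_apply, Equiv.swap_apply_self, hu]
  simp only [Equiv.swap_apply_def]
  have hx := x.2
  have hy := y.2
  simp only [Fin.lt_def, Fin.ext_iff, ne_eq] at *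
  generalize (w x : ℕ) = p at *
  generalize (w y : ℕ) = q at *
  generalize u x = c at *
  generalize u y = d at *
  split_ifs <;> grind

lemma word_bound (n : ℕ) [NeZero n] (hn : 2 ≤ n) (l : List (Fin n)) :
    ∃ (v : Fin n → ℤ) (w : Equiv.Perm (Fin n)),
      (l.map (saff n)).prod = E n v w ∧ ∑ x, v x = 0 ∧ F (v ∘ w) w ≤ 2 * l.length := by
  induction l using List.reverseRecOn with
  | nil =>
    refine ⟨0, 1, rfl, by simp, ?_⟩
    have : F ((0 : Fin n → ℤ) ∘ (1 : Equiv.Perm (Fin n))) (1 : Equiv.Perm (Fin n)) = 0 := by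
      unfold F
      refine Finset.sum_eq_zero fun x _ => Finset.sum_eq_zero fun y _ => ?_
      simp only [G, Function.comp_apply, Pi.zero_apply, Equiv.Perm.one_apply]
      split_ifs <;> first | rfl | (exfalso; order) | simp [*]
    rw [this]; simp
  | append_singleton l j ih =>
    obtain ⟨v, w, h1, h2, h3⟩ := ih
    rw [List.map_append, List.prod_append, h1]
    simp only [List.map_cons, List.map_nil, List.prod_cons, List.prod_nil, mul_one,
      List.length_append, List.length_cons, List.length_nil]
    have hj := j.2
    by_cases hj0 : (j : ℕ) = 0
    · have e0 := finOf_val n 0 (by omega)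
      have e1 := finOf_val n (n - 1) (by omega)
      have hs : saff n j = E n (Pi.single (finOf n (n - 1)) 1 - Pi.single (finOf n 0) 1)
          (Equiv.swap (finOf n 0) (finOf n (n - 1))) := by
        have hx : ((List.range (n - 1)).map (tauN n)).prod = E n (ind n (n - 1)) 1 :=
          xel_eq n (n - 1) (by omega)
        rw [saff, if_pos hj0, s0, hx, fperm_eq, tauN_eq, E_mul, E_mul]
        refine E_congr (-1) (by simp) ?_
        intro x
        have hx := x.2
        simp only [Pi.sub_apply, Pi.add_apply, Function.comp_apply, Pi.zero_apply, ind,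
          mul_one, Equiv.symm_swap, Equiv.swap_apply_def, Pi.single_apply, Fin.ext_iff, e0, e1]
        split_ifs <;> grind
      set a := finOf n 0
      set b := finOf n (n - 1)
      have hab : a ≠ b := by intro h; rw [Fin.ext_iff, e0, e1] at h; omega
      rw [hs, E_mul]
      refine ⟨_, _, rfl, ?_, ?_⟩
      · simp only [Pi.add_apply, Finset.sum_add_distrib, h2, Function.comp_apply]
        have hc := Equiv.sum_comp w.symm (fun x => (Pi.single b 1 - Pi.single a 1 : Fin n → ℤ) x)
        refine (congrArg (fun t : ℤ => 0 + t) hc).trans ?_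
        simp
      · have := F_step (v ∘ w) ((v + (Pi.single b 1 - Pi.single a 1 : Fin n → ℤ) ∘ w.symm) ∘
          (w * Equiv.swap a b : Equiv.Perm (Fin n))) w (w ∘ Equiv.swap a b) a b
          (G_aff _ _ w a b e0 (by rw [e1]; omega) hab (by
            intro x
            simp [Pi.single_apply, Equiv.Perm.mul_apply]
            ring))
        push_cast
        rw [Equiv.Perm.coe_mul] at this
        linarith
    · have hs : saff n j = E n 0 (sNp n j) := by rw [saff, if_neg hj0]; rfl
      rw [hs, E_mul]
      refine ⟨_, _, rfl, by simpa using h2, ?_⟩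
      have e0 := finOf_val n (j - 1) (by omega)
      have e1 := finOf_val n j (by omega)
      have := F_step (v ∘ w) _ w _ _ _ (G_fin (v ∘ w) w (finOf n (j - 1)) (finOf n j) (by omega))
      push_cast
      have hz : (v + (0 : Fin n → ℤ) ∘ w.symm) = v := by ext; simp
      rw [hz, sNp, ← Function.comp_assoc]
      linarith

lemma sum_ind (n i : ℕ) (h : i ≤ n) : ∑ x, ind n i x = i := by
  unfold ind
  rw [Fin.sum_univ_eq_sum_range (fun x => if x < i then (1 : ℤ) else 0), ← Finset.sum_filter]
  have : (Finset.range n).filter (fun x => x < i) = Finset.range i := by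
    ext x; simp; omega
  rw [this]; simp

lemma F_final (n i : ℕ) (h : i ≤ n) (u : Fin n → ℤ) (m : ℤ) (hu : ∀ x, u x = m)
    (w : Fin n → Fin n)
    (hw : ∀ x : Fin n, (w x : ℕ) = if (x : ℕ) < i then (x : ℕ) + (n - i) else (x : ℕ) - i) :
    2 * ((i * (n - i) : ℕ) : ℤ) ≤ F u w := by
  have hG : ∀ x y : Fin n, ind n i x * (1 - ind n i y) + (1 - ind n i x) * ind n i y ≤ G u w x y := by
    intro x y
    have hx := x.2
    have hy := y.2
    simp only [G, ind, hu, Fin.lt_def, hw]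
    by_cases h1 : (x : ℕ) < i <;> by_cases h2 : (y : ℕ) < i <;> simp only [h1, h2, if_true, if_false]
    · simp; split_ifs <;> simp
    · have : (x : ℕ) < y := by omega
      have : (y : ℕ) - i < x + (n - i) := by omega
      simp [*]
    · have : (y : ℕ) < x := by omega
      have : ¬ (x : ℕ) < y := by omega
      have : (x : ℕ) - i < y + (n - i) := by omega
      simp [*]
    · simp; split_ifs <;> simp
  have h2 := Finset.sum_le_sum fun x (_ : x ∈ Finset.univ) =>
    Finset.sum_le_sum fun y (_ : y ∈ Finset.univ) => hG x y
  have hs := sum_ind n i h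
  have : ∑ x, (1 - ind n i x) = (n : ℤ) - i := by
    rw [Finset.sum_sub_distrib, hs]; simp
  simp only [Finset.sum_add_distrib, ← Finset.mul_sum, ← Finset.sum_mul, hs, this] at h2
  unfold F
  push_cast [h]
  linarith

end XW

/-- In `S̃_n`, `x_i = ω^i (s_{n-i} ⋯ s_1)(s_{n-i+1} ⋯ s_2) ⋯ (s_{n-1} ⋯ s_i)`,
and this expression for `ω^{-i} x_i` is reduced, so `l(x_i) = i(n-i)`. -/
theorem x_eq_om_word (n : ℕ) [NeZero n] (hn : 2 ≤ n) (i : ℕ)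
    (hi1 : 1 ≤ i) (hi2 : i ≤ n - 1) :
    xel n i = om n ^ i *
        ((((List.range i).map (fun t =>
            (List.range (n - i)).map (fun r => n - i + t - r))).flatten.map
          (sfin n)).prod) ∧
      lenT n (xel n i) = i * (n - i) := by
  change xel n i = om n ^ i * ((XW.wd (n - i) i).map (sfin n)).prod ∧ _
  have hP := XW.wd_perm n (n - i) i (by omega)
  set P := ((XW.wd (n - i) i).map (sNp n)).prod with hPdef
  have hmain : xel n i = om n ^ i * ((XW.wd (n - i) i).map (sfin n)).prod := by
    rw [XW.fperm_prod, XW.xel_eq n i (by omega), XW.om_pow n i (by omega), XW.fperm_eq, XW.E_mul]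
    refine XW.E_congr 0 ?_ ?_
    · ext x
      have hx := x.2
      rw [Equiv.Perm.mul_apply, XW.cyc_pow_val, ← hPdef, hP]
      split_ifs with h1 h2
      · have : (x : ℕ) + (n - i) + i = x + n := by omega
        rw [this, Nat.add_mod_right, Nat.mod_eq_of_lt hx]; rfl
      · have : (x : ℕ) - i + i = x := by omega
        rw [this, Nat.mod_eq_of_lt hx]; rfl
      · omega
    · intro x; simp
  refine ⟨hmain, ?_⟩
  apply le_antisymm
  · apply Nat.sInf_le
    refine ⟨i, (XW.wd (n - i) i).map (finOf n), ?_, ?_⟩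
    · rw [List.length_map, XW.wd_length]
    · rw [hmain, zpow_natCast, List.map_map]
      congr 2
      apply List.map_congr_left
      intro j hj
      have hj := XW.wd_mem _ _ _ hj
      have e := XW.finOf_val n j (by omega)
      rw [Function.comp_apply, saff, e, if_neg (by omega)]
  · apply le_csInf
    · exact ⟨_, i, (XW.wd (n - i) i).map (finOf n), rfl, by
        rw [hmain, zpow_natCast, List.map_map]
        congr 2
        apply List.map_congr_left
        intro j hj
        have hj := XW.wd_mem _ _ _ hj
        have e := XW.finOf_val n j (by omega)
        rw [Function.comp_apply, saff, e, if_neg (by omega)]⟩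
    · rintro _ ⟨a, l, rfl, hl⟩
      obtain ⟨v, w, h1, h2, h3⟩ := XW.word_bound n hn l
      have hn0 : (0 : ℤ) < n := by omega
      obtain ⟨k, hk⟩ := Int.eq_ofNat_of_zero_le (Int.emod_nonneg a hn0.ne')
      have hkn : k < n := by have := Int.emod_lt_of_pos a hn0; omega
      have ha : om n ^ a = om n ^ k := by
        rw [← Int.emod_add_mul_ediv a n, zpow_add, zpow_mul, zpow_natCast, XW.om_pow_n, hk]
        simp
      rw [ha, h1] at hl
      have hl2 := hl
      rw [XW.xel_eq n i (by omega), XW.om_pow n k hkn.le, XW.E_mul] at hl2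
      obtain ⟨-, m, hm⟩ := XW.E_eq hl2
      have hsum := Finset.sum_congr rfl fun x (_ : x ∈ Finset.univ) => hm x
      simp only [Pi.add_apply, Finset.sum_add_distrib, Function.comp_apply] at hsum
      have hc := Equiv.sum_comp (XW.cyc n ^ k).symm v
      rw [hc, h2, XW.sum_ind n i (by omega), XW.sum_ind n k hkn.le] at hsum
      simp only [Finset.sum_const, Finset.card_univ, Fintype.card_fin, nsmul_eq_mul] at hsum
      have hm0 : m = 0 := by
        have u1 : (n : ℤ) * m < n * 1 := by omega
        have u2 : (n : ℤ) * (-1) < n * m := by omega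
        have u3 := lt_of_mul_lt_mul_left u1 hn0.le
        have u4 := lt_of_mul_lt_mul_left u2 hn0.le
        omega
      have hki : k = i := by
        rw [hm0] at hsum; omega
      subst hki
      rw [hmain] at hl
      have hl3 := mul_left_cancel hl
      rw [XW.fperm_prod, XW.fperm_eq] at hl3
      obtain ⟨hw, m', hm'⟩ := XW.E_eq hl3
      have hF := XW.F_final n k hkn.le (v ∘ w) m' (by intro x; simp [hm' (w x)]) w (by
        intro x
        have hx := x.2
        rw [← hw, hP]
        split_ifs <;> omega)
      have := hF.trans h3
      zify
      push_cast at this ⊢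
      linarith
end
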